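/- Let X_1, X_2, … be i.i.d. ℝ^d-valued random vectors with common law P such that Λ(λ) := log E_P[e^{⟨λ,X⟩}] < +∞ for all λ ∈ ℝ^d, and let μ_n be the law of Ŝ_n = (1/n)∑_{i=1}^n X_i. Define γ(α) := inf{ D(Q‖P) : Q a probability measure on ℝ^d with X Q-integrable and ∫ x dQ(x) = α }. Then: (a) for every closed set F ⊆ ℝ^d, liminf_{n→∞} −(1/n) log μ_n(F) ≥ inf_{x∈F} γ(x); (b) for every open set G ⊆ ℝ^d, limsup_{n→∞} −(1/n) log μ_n(G) ≤ inf_{x∈G} γ(x). -/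

import Mathlib

open MeasureTheory Filter Topology
open scoped ENNReal NNReal Classical

/-- Relative entropy `D(Q‖P)`: `∫ log (dQ/dP) dQ` if `Q ≪ P` (and the integral is
well-defined), `+∞` otherwise. -/
noncomputable def relEnt {X : Type*} [MeasurableSpace X] (Q P : Measure X) : ℝ≥0∞ :=
  if Q ≪ P ∧ Integrable (llr Q P) Q then ENNReal.ofReal (∫ x, llr Q P x ∂Q) else ⊤

/-- `-(1/n) log p`, as an extended real number. -/
noncomputable def negLogRate (n : ℕ) (p : ℝ≥0∞) : EReal :=
  (-(((n : ℝ)⁻¹ : ℝ) : EReal)) * ENNReal.log p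

/-- The Cramér rate function on `ℝ^d`: `γ(α) = inf { D(Q‖P) : E_Q[X] = α }`. -/
noncomputable def cramerRateRd {d : ℕ} (P : Measure (Fin d → ℝ)) (α : Fin d → ℝ) : ℝ≥0∞ :=
  ⨅ (Q : Measure (Fin d → ℝ)) (_ : IsProbabilityMeasure Q)
    (_ : Integrable (fun y => y) Q) (_ : ∫ y, y ∂Q = α), relEnt Q P

/-- The law `μ_n` of the sample mean of `n` i.i.d. samples from `P` on `ℝ^d`. -/
noncomputable def sampleMeanLawRd {d : ℕ} (P : Measure (Fin d → ℝ)) (n : ℕ) :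
    Measure (Fin d → ℝ) :=
  Measure.map (fun x : Fin n → (Fin d → ℝ) => (n : ℝ)⁻¹ • ∑ i, x i)
    (Measure.pi fun _ : Fin n => P)

open InformationTheory ProbabilityTheory

lemma relEnt_eq_klDiv {X : Type*} [MeasurableSpace X] (Q P : Measure X)
    [IsProbabilityMeasure Q] [IsProbabilityMeasure P] : relEnt Q P = klDiv Q P := by
  simp [relEnt, klDiv_def]

/-- The Fenchel-Young inequality for the pair `klFun`, `exp - 1`. -/
lemma mul_le_klFun_add_exp_sub_one {x : ℝ} (hx : 0 ≤ x) (t : ℝ) :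
    t * x ≤ klFun x + (Real.exp t - 1) := by
  rw [klFun_apply]
  rcases hx.eq_or_lt with rfl | hx
  · simp [Real.exp_nonneg]
  · have h := Real.add_one_le_exp (t - Real.log x)
    rw [Real.exp_sub, Real.exp_log hx, le_div_iff₀ hx] at h
    linarith

/-- The convexity defect of `klFun` controls the squared Hellinger distance. -/
lemma sq_sqrt_sub_sqrt_le_klFun {x y : ℝ} (hx : 0 ≤ x) (hy : 0 ≤ y) :
    (√x - √y) ^ 2 / 2 + 2 * klFun ((x + y) / 2) ≤ klFun x + klFun y := by
  have key : ∀ {z m : ℝ}, 0 ≤ z → 0 ≤ m → (m = 0 → z = 0) →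
      2 * z - 2 * (√z * √m) ≤ z * Real.log z - z * Real.log m := by
    intro z m hz hm h
    rcases hz.eq_or_lt with rfl | hz
    · simp
    have hm : 0 < m := hm.lt_of_ne fun h0 => hz.ne' (h h0.symm)
    have h1 := Real.add_one_le_exp ((Real.log m - Real.log z) / 2)
    have h2 : Real.exp ((Real.log m - Real.log z) / 2) = √m / √z := by
      rw [Real.exp_half, Real.exp_sub, Real.exp_log hm, Real.exp_log hz, Real.sqrt_div hm.le]
    have h3 := mul_le_mul_of_nonneg_left (h2 ▸ h1) hz.le
    have h4 : z * (√m / √z) = √z * √m := by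
      have : 0 < √z := Real.sqrt_pos.2 hz
      field_simp
      rw [Real.sq_sqrt hz.le]
    rw [h4] at h3
    linarith
  have hm : 0 ≤ (x + y) / 2 := by positivity
  have h1 := key hx hm (by intro; linarith)
  have h2 := key hy hm (by intro; linarith)
  have e1 := Real.sq_sqrt hx
  have e2 := Real.sq_sqrt hy
  have e3 := Real.sq_sqrt hm
  simp only [klFun_apply]
  nlinarith [sq_nonneg (√x + √y - 2 * √((x + y) / 2))]

lemma exp_mul_norm_le_sum {d : ℕ} (c : ℝ) (x : Fin d → ℝ) :
    Real.exp (c * ‖x‖) ≤ 1 + ∑ j, (Real.exp (c * x j) + Real.exp (-c * x j)) := by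
  have hpos : ∀ j ∈ Finset.univ, 0 ≤ Real.exp (c * x j) + Real.exp (-c * x j) :=
    fun j _ => by positivity
  rcases isEmpty_or_nonempty (Fin d) with h | h
  · simp [Subsingleton.elim x 0]
  obtain ⟨j, hj⟩ := (Finite.exists_max fun j => ‖x j‖)
  have hx : ‖x‖ = |x j| := le_antisymm ((pi_norm_le_iff_of_nonneg (norm_nonneg _)).2 hj)
    (norm_le_pi_norm x j)
  have h1 := Finset.single_le_sum hpos (Finset.mem_univ j)
  rw [hx]
  rcases abs_cases (x j) with ⟨h, _⟩ | ⟨h, _⟩ <;> rw [h]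
  · linarith [Real.exp_pos (-c * x j)]
  · rw [mul_neg, ← neg_mul]
    linarith [Real.exp_pos (c * x j)]

lemma integrable_exp_mul_norm {d : ℕ} {P : Measure (Fin d → ℝ)} [IsProbabilityMeasure P]
    (hΛ : ∀ l : Fin d → ℝ,
      ∫⁻ x, ENNReal.ofReal (Real.exp (∑ j, l j * x j)) ∂P < ⊤) (c : ℝ) :
    Integrable (fun x => Real.exp (c * ‖x‖)) P := by
  have h : ∀ (j : Fin d) (a : ℝ), Integrable (fun x => Real.exp (a * x j)) P := by
    intro j a
    refine (lintegral_ofReal_ne_top_iff_integrable (Measurable.aestronglyMeasurable (by fun_prop))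
      (ae_of_all _ fun _ => Real.exp_nonneg _)).1 ?_
    simpa [Pi.single_apply] using (hΛ (Pi.single j a)).ne
  have h2 : Integrable (fun x => 1 + ∑ j, (Real.exp (|c| * x j) + Real.exp (-|c| * x j))) P :=
    (integrable_const 1).add (integrable_finsetSum _ fun j _ => (h j _).add (h j _))
  refine h2.mono' (Measurable.aestronglyMeasurable (by fun_prop)) (ae_of_all _ fun x => ?_)
  rw [Real.norm_of_nonneg (Real.exp_nonneg _)]
  exact (Real.exp_le_exp.2 (by gcongr; exact le_abs_self c)).trans
    (exp_mul_norm_le_sum |c| x)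

section Density

variable {α F : Type*} [MeasurableSpace α] [NormedAddCommGroup F] [NormedSpace ℝ F]
  {P : Measure α} {f : α → ℝ} {φ : α → F}

/-- The relative entropy with respect to `P` of the measure with density `f`. -/
noncomputable def densityEnt (P : Measure α) (f : α → ℝ) : ℝ≥0∞ :=
  ∫⁻ x, ENNReal.ofReal (klFun (f x)) ∂P

lemma setLIntegral_enorm_smul_le (hf : Measurable f) (hf0 : 0 ≤ f) (s : Set α)
    {c : ℝ} (hc : 0 < c) :
    ∫⁻ x in s, ‖f x • φ x‖ₑ ∂P ≤ ENNReal.ofReal c⁻¹ *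
      (densityEnt P f + ∫⁻ x in s, ENNReal.ofReal (Real.exp (c * ‖φ x‖)) ∂P) := by
  have hk : Measurable fun x => ENNReal.ofReal (klFun (f x)) := by fun_prop
  calc ∫⁻ x in s, ‖f x • φ x‖ₑ ∂P
      ≤ ∫⁻ x in s, ENNReal.ofReal c⁻¹ *
        (ENNReal.ofReal (klFun (f x)) + ENNReal.ofReal (Real.exp (c * ‖φ x‖))) ∂P := by
        refine lintegral_mono fun x => ?_
        rw [← ENNReal.ofReal_add (klFun_nonneg (hf0 x)) (Real.exp_nonneg _),
          ← ENNReal.ofReal_mul (by positivity), ← ofReal_norm, norm_smul,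
          Real.norm_of_nonneg (hf0 x)]
        refine ENNReal.ofReal_le_ofReal ?_
        rw [← div_eq_inv_mul, le_div_iff₀ hc]
        linarith [mul_le_klFun_add_exp_sub_one (hf0 x) (c * ‖φ x‖)]
    _ = ENNReal.ofReal c⁻¹ * (∫⁻ x in s, ENNReal.ofReal (klFun (f x)) ∂P +
          ∫⁻ x in s, ENNReal.ofReal (Real.exp (c * ‖φ x‖)) ∂P) := by
        rw [lintegral_const_mul' _ _ ENNReal.ofReal_ne_top, lintegral_add_left hk]
    _ ≤ _ := by
        gcongr
        exact setLIntegral_le_lintegral _ _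

lemma integrable_smul_of_densityEnt_ne_top (hf : Measurable f) (hf0 : 0 ≤ f)
    (hent : densityEnt P f ≠ ⊤) (hφ : AEStronglyMeasurable φ P)
    (hexp : Integrable (fun x => Real.exp (1 * ‖φ x‖)) P) :
    Integrable (fun x => f x • φ x) P := by
  refine ⟨hf.aestronglyMeasurable.smul hφ, ?_⟩
  have h := setLIntegral_enorm_smul_le (P := P) (φ := φ) hf hf0 Set.univ one_pos
  rw [Measure.restrict_univ] at h
  refine h.trans_lt (ENNReal.mul_lt_top ENNReal.ofReal_lt_top (ENNReal.add_lt_top.2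
    ⟨hent.lt_top, ?_⟩))
  exact hexp.lintegral_lt_top

lemma unifIntegrable_smul_of_densityEnt_le {f : ℕ → α → ℝ} (hf : ∀ n, Measurable (f n))
    (hf0 : ∀ n, 0 ≤ f n) {M : ℝ≥0∞} (hM : M ≠ ⊤) (hent : ∀ n, densityEnt P (f n) ≤ M)
    (hexp : ∀ c : ℝ, Integrable (fun x => Real.exp (c * ‖φ x‖)) P) :
    UnifIntegrable (fun n x => f n x • φ x) 1 P := by
  intro ε hε
  obtain ⟨c, hc, hcε⟩ : ∃ c : ℝ, 0 < c ∧ ENNReal.ofReal c⁻¹ * (M + 1) ≤ ENNReal.ofReal ε := by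
    refine ⟨((M + 1).toReal + 1) / ε, by positivity, ?_⟩
    rw [← ENNReal.ofReal_toReal (a := M + 1) (by simp [hM]),
      ← ENNReal.ofReal_mul (by positivity), ENNReal.toReal_ofReal (by positivity)]
    refine ENNReal.ofReal_le_ofReal ?_
    rw [inv_div, div_mul_eq_mul_div, div_le_iff₀ (by positivity)]
    nlinarith
  obtain ⟨δ, hδ, hδs⟩ := exists_pos_setLIntegral_lt_of_measure_lt
    (hexp c).lintegral_lt_top.ne one_ne_zero
  obtain ⟨r, hr, hrδ⟩ := ENNReal.lt_iff_exists_nnreal_btwn.1 hδ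
  refine ⟨r, by exact_mod_cast hr, fun n s hs hPs => ?_⟩
  rw [eLpNorm_indicator_eq_eLpNorm_restrict hs, eLpNorm_one_eq_lintegral_enorm]
  refine (setLIntegral_enorm_smul_le (hf n) (hf0 n) s hc).trans (le_trans ?_ hcε)
  gcongr
  · exact hent n
  · exact (hδs s (hPs.trans_lt (by simpa using hrδ))).le

lemma isProbabilityMeasure_withDensity_ofReal (hf1 : ∫⁻ x, ENNReal.ofReal (f x) ∂P = 1) :
    IsProbabilityMeasure (P.withDensity fun x => ENNReal.ofReal (f x)) :=
  ⟨by simpa using hf1⟩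

lemma relEnt_withDensity_ofReal [IsProbabilityMeasure P] (hf : Measurable f) (hf0 : 0 ≤ f)
    (hf1 : ∫⁻ x, ENNReal.ofReal (f x) ∂P = 1) :
    relEnt (P.withDensity fun x => ENNReal.ofReal (f x)) P = densityEnt P f := by
  have := isProbabilityMeasure_withDensity_ofReal hf1
  rw [relEnt_eq_klDiv, klDiv_eq_lintegral_klFun_of_ac (withDensity_absolutelyContinuous _ _)]
  refine lintegral_congr_ae ?_
  filter_upwards [Measure.rnDeriv_withDensity P hf.ennreal_ofReal] with x hx
  rw [hx, ENNReal.toReal_ofReal (hf0 x)]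

end Density

section Rate

variable {d : ℕ} {P : Measure (Fin d → ℝ)} [IsProbabilityMeasure P]

lemma cramerRateRd_le_densityEnt {f : (Fin d → ℝ) → ℝ} (hf : Measurable f) (hf0 : 0 ≤ f)
    (hf1 : ∫⁻ x, ENNReal.ofReal (f x) ∂P = 1) (hfi : Integrable (fun x => f x • x) P) :
    cramerRateRd P (∫ x, f x • x ∂P) ≤ densityEnt P f := by
  have := isProbabilityMeasure_withDensity_ofReal hf1
  rw [← relEnt_withDensity_ofReal hf hf0 hf1]
  refine iInf₂_le_of_le _ this (iInf₂_le_of_le ?_ ?_ le_rfl)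
  · rw [integrable_withDensity_iff_integrable_smul' hf.ennreal_ofReal (by simp)]
    simpa [ENNReal.toReal_ofReal (hf0 _)] using hfi
  · rw [integral_withDensity_eq_integral_toReal_smul hf.ennreal_ofReal (by simp)]
    simp [ENNReal.toReal_ofReal (hf0 _)]

lemma exists_density_of_cramerRateRd_lt {a : Fin d → ℝ} {L : ℝ≥0∞} (h : cramerRateRd P a < L) :
    ∃ f : (Fin d → ℝ) → ℝ, Measurable f ∧ 0 ≤ f ∧ ∫⁻ x, ENNReal.ofReal (f x) ∂P = 1 ∧
      Integrable (fun x => f x • x) P ∧ ∫ x, f x • x ∂P = a ∧ densityEnt P f < L := by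
  simp only [cramerRateRd, iInf_lt_iff] at h
  obtain ⟨Q, hQ, hQi, rfl, hL⟩ := h
  rw [relEnt_eq_klDiv] at hL
  have hQP : Q ≪ P := (klDiv_ne_top_iff.1 hL.ne_top).1
  have := Measure.haveLebesgueDecomposition_of_sigmaFinite Q P
  refine ⟨fun x => (Q.rnDeriv P x).toReal, by fun_prop, fun x => ENNReal.toReal_nonneg, ?_,
    (integrable_rnDeriv_smul_iff hQP).2 hQi, integral_rnDeriv_smul hQP, ?_⟩
  · have : (fun x => ENNReal.ofReal (Q.rnDeriv P x).toReal) =ᵐ[P] Q.rnDeriv P := by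
      filter_upwards [Q.rnDeriv_lt_top P] with x hx using ENNReal.ofReal_toReal hx.ne
    rw [lintegral_congr_ae this, Measure.lintegral_rnDeriv hQP, measure_univ]
  · rwa [klDiv_eq_lintegral_klFun_of_ac hQP] at hL

end Rate

section LowerSemicontinuity

variable {α : Type*} [MeasurableSpace α]

lemma lintegral_sq_sqrt_sub_sqrt_le_densityEnt {P : Measure α} {f g : α → ℝ}
    (hf : Measurable f) (hf0 : 0 ≤ f) (hg : Measurable g) (hg0 : 0 ≤ g) :
    ∫⁻ x, ‖√(f x) - √(g x)‖ₑ ^ 2 ∂P + 4 * densityEnt P (fun x => (f x + g x) / 2) ≤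
      2 * densityEnt P f + 2 * densityEnt P g := by
  have hm0 : ∀ x, 0 ≤ (f x + g x) / 2 := fun x => by
    have := hf0 x; have := hg0 x; simp only [Pi.zero_apply] at *; positivity
  unfold densityEnt
  rw [← lintegral_const_mul' _ _ (by simp), ← lintegral_const_mul' _ _ (by simp),
    ← lintegral_const_mul' _ _ (by simp), ← lintegral_add_left (by fun_prop),
    ← lintegral_add_left (by fun_prop)]
  refine lintegral_mono fun x => ?_
  have h4 : (4 : ℝ≥0∞) = ENNReal.ofReal 4 := by simp
  have h2 : (2 : ℝ≥0∞) = ENNReal.ofReal 2 := by simp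
  have e : ‖√(f x) - √(g x)‖ₑ ^ 2 = ENNReal.ofReal ((√(f x) - √(g x)) ^ 2) := by
    rw [← ofReal_norm, ← ENNReal.ofReal_pow (norm_nonneg _), Real.norm_eq_abs, sq_abs]
  have k1 := klFun_nonneg (hf0 x)
  have k2 := klFun_nonneg (hg0 x)
  have k3 := klFun_nonneg (hm0 x)
  dsimp only
  rw [e, h4, h2, ← ENNReal.ofReal_mul (by norm_num), ← ENNReal.ofReal_mul (by norm_num),
    ← ENNReal.ofReal_mul (by norm_num), ← ENNReal.ofReal_add (by positivity) (by positivity),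
    ← ENNReal.ofReal_add (by positivity) (by positivity)]
  refine ENNReal.ofReal_le_ofReal ?_
  linarith [sq_sqrt_sub_sqrt_le_klFun (hf0 x) (hg0 x)]

variable {d : ℕ} {P : Measure (Fin d → ℝ)} [IsProbabilityMeasure P]

/-- Sequences of densities with bounded entropy converging almost everywhere pass their mean and
their entropy bound to the limit. -/
lemma cramerRateRd_le_of_tendsto_ae
    (hP : ∀ c : ℝ, Integrable (fun x => Real.exp (c * ‖x‖)) P)
    {f : ℕ → (Fin d → ℝ) → ℝ} {g : (Fin d → ℝ) → ℝ} {b : ℕ → ℝ≥0∞} {S : ℝ≥0∞} {a : Fin d → ℝ}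
    (hf : ∀ n, Measurable (f n)) (hf0 : ∀ n, 0 ≤ f n)
    (hf1 : ∀ n, ∫⁻ x, ENNReal.ofReal (f n x) ∂P = 1)
    (hfa : Tendsto (fun n => ∫ x, f n x • x ∂P) atTop (𝓝 a))
    (hb : Tendsto b atTop (𝓝 S)) {M : ℝ≥0∞} (hM : M ≠ ⊤) (hbM : ∀ n, b n ≤ M)
    (hfb : ∀ n, densityEnt P (f n) ≤ b n)
    (hg : Measurable g) (hg0 : 0 ≤ g)
    (hlim : ∀ᵐ x ∂P, Tendsto (fun n => f n x) atTop (𝓝 (g x))) :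
    cramerRateRd P a ≤ S := by
  have hgS : densityEnt P g ≤ S := by
    calc densityEnt P g = ∫⁻ x, liminf (fun n => ENNReal.ofReal (klFun (f n x))) atTop ∂P := by
          refine lintegral_congr_ae ?_
          filter_upwards [hlim] with x hx
          exact (((ENNReal.continuous_ofReal.comp continuous_klFun).tendsto _).comp
            hx).liminf_eq.symm
      _ ≤ liminf (fun n => densityEnt P (f n)) atTop :=
          lintegral_liminf_le fun n => by have := hf n; fun_prop
      _ ≤ liminf b atTop := liminf_le_liminf (Eventually.of_forall hfb)
      _ = S := hb.liminf_eq
  have hSM : S ≤ M := le_of_tendsto' hb hbM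
  have hgtop : densityEnt P g ≠ ⊤ := ((hgS.trans hSM).trans_lt hM.lt_top).ne
  have conv : ∀ {F : Type} [NormedAddCommGroup F] [NormedSpace ℝ F] (φ : (Fin d → ℝ) → F),
      AEStronglyMeasurable φ P → (∀ c : ℝ, Integrable (fun x => Real.exp (c * ‖φ x‖)) P) →
      Integrable (fun x => g x • φ x) P ∧
      Tendsto (fun n => ∫ x, f n x • φ x ∂P) atTop (𝓝 (∫ x, g x • φ x ∂P)) := by
    intro F _ _ φ hφ hexp
    have hgi := integrable_smul_of_densityEnt_ne_top hg hg0 hgtop hφ (hexp 1)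
    refine ⟨hgi, tendsto_integral_of_L1' _ hgi.1 (Eventually.of_forall fun n =>
      integrable_smul_of_densityEnt_ne_top (hf n) (hf0 n)
        (((hfb n).trans (hbM n)).trans_lt hM.lt_top).ne hφ (hexp 1)) ?_⟩
    refine tendsto_Lp_finite_of_tendsto_ae le_rfl (by simp)
      (fun n => (hf n).aestronglyMeasurable.smul hφ) (memLp_one_iff_integrable.2 hgi)
      (unifIntegrable_smul_of_densityEnt_le hf hf0 hM (fun n => (hfb n).trans (hbM n)) hexp) ?_
    filter_upwards [hlim] with x hx using hx.smul_const _
  obtain ⟨hgi, hgm⟩ := conv id aestronglyMeasurable_id (by simpa using hP)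
  obtain ⟨hgi1, hgm1⟩ := conv (fun _ => (1 : ℝ)) aestronglyMeasurable_const
    (fun c => integrable_const _)
  simp only [smul_eq_mul, mul_one] at hgi1 hgm1
  have hfi1 : ∀ n, ∫ x, f n x ∂P = 1 := fun n => by
    rw [integral_eq_lintegral_of_nonneg_ae (ae_of_all _ (hf0 n)) (hf n).aestronglyMeasurable,
      hf1 n, ENNReal.toReal_one]
  have hg1 : ∫⁻ x, ENNReal.ofReal (g x) ∂P = 1 := by
    rw [← ofReal_integral_eq_lintegral_ofReal hgi1 (ae_of_all _ hg0)]
    simp only [hfi1] at hgm1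
    rw [tendsto_nhds_unique hgm1 tendsto_const_nhds, ENNReal.ofReal_one]
  rw [tendsto_nhds_unique hfa hgm]
  exact (cramerRateRd_le_densityEnt hg hg0 hg1 hgi).trans hgS

lemma iInf_closedBall_le_densityEnt_midpoint {f g : (Fin d → ℝ) → ℝ} {a : Fin d → ℝ} {r : ℝ}
    (hf : Measurable f) (hf0 : 0 ≤ f) (hf1 : ∫⁻ x, ENNReal.ofReal (f x) ∂P = 1)
    (hfi : Integrable (fun x => f x • x) P) (hfa : ∫ x, f x • x ∂P ∈ Metric.closedBall a r)
    (hg : Measurable g) (hg0 : 0 ≤ g) (hg1 : ∫⁻ x, ENNReal.ofReal (g x) ∂P = 1)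
    (hgi : Integrable (fun x => g x • x) P) (hga : ∫ x, g x • x ∂P ∈ Metric.closedBall a r) :
    ⨅ x ∈ Metric.closedBall a r, cramerRateRd P x ≤
      densityEnt P (fun x => (f x + g x) / 2) := by
  have hm0 : (0 : (Fin d → ℝ) → ℝ) ≤ fun x => (f x + g x) / 2 := fun x => by
    have := hf0 x; have := hg0 x; simp only [Pi.zero_apply] at *; positivity
  have hm : (fun x => ((f x + g x) / 2) • x) =
      fun x => (2⁻¹ : ℝ) • (f x • x) + (2⁻¹ : ℝ) • (g x • x) := by
    ext x : 1
    rw [← smul_add, ← add_smul, smul_smul]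
    congr 1
    ring
  have hmi : Integrable (fun x => ((f x + g x) / 2) • x) P := by
    rw [hm]
    exact (hfi.smul (2⁻¹ : ℝ)).add (hgi.smul (2⁻¹ : ℝ))
  have hm1 : ∫⁻ x, ENNReal.ofReal ((f x + g x) / 2) ∂P = 1 := by
    have : ∀ x, ENNReal.ofReal ((f x + g x) / 2) =
        2⁻¹ * (ENNReal.ofReal (f x) + ENNReal.ofReal (g x)) := fun x => by
      rw [← ENNReal.ofReal_add (hf0 x) (hg0 x), ENNReal.ofReal_div_of_pos two_pos,
        ENNReal.ofReal_ofNat, ENNReal.div_eq_inv_mul]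
    simp only [this]
    rw [lintegral_const_mul' _ _ (by simp), lintegral_add_left hf.ennreal_ofReal, hf1, hg1,
      one_add_one_eq_two, ENNReal.inv_mul_cancel (by simp) (by simp)]
  refine iInf₂_le_of_le _ ?_ (cramerRateRd_le_densityEnt (by fun_prop) hm0 hm1 hmi)
  rw [hm, integral_add (hfi.fun_smul (2⁻¹ : ℝ)) (hgi.fun_smul (2⁻¹ : ℝ)), integral_smul,
    integral_smul]
  exact convex_closedBall a r hfa hga (by norm_num) (by norm_num) (by norm_num)

theorem lowerSemicontinuous_cramerRateRd
    (hP : ∀ c : ℝ, Integrable (fun x => Real.exp (c * ‖x‖)) P) :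
    LowerSemicontinuous (cramerRateRd P) := by
  intro a y hy
  by_contra hcon
  rw [not_eventually] at hcon
  set V : ℝ → ℝ≥0∞ := fun r => ⨅ x ∈ Metric.closedBall a r, cramerRateRd P x with hV
  have hVanti : Antitone V := fun r s hrs =>
    biInf_mono fun x hx => Metric.closedBall_subset_closedBall hrs hx
  set S : ℝ≥0∞ := ⨆ r : ℝ, ⨆ _ : 0 < r, V r with hS
  have hSy : S ≤ y := by
    refine iSup₂_le fun r hr => ?_
    obtain ⟨x, hx, hxr⟩ := (hcon.and_eventually (Metric.closedBall_mem_nhds a hr)).exists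
    exact iInf₂_le_of_le x hxr (not_lt.1 hx)
  have hStop : S ≠ ⊤ := (hSy.trans_lt (hy.trans_le le_top)).ne
  set δ : ℕ → ℝ≥0∞ := fun n => (2⁻¹ ^ n) ^ 2 with hδ
  have hδpos : ∀ n, δ n ≠ 0 := fun n => by simp [hδ]
  have hδ1 : ∀ n, δ n ≤ 1 := fun n => pow_le_one₀ zero_le (pow_le_one₀ zero_le (by simp))
  have hδanti : Antitone δ := fun m n h =>
    pow_le_pow_left₀ zero_le (pow_le_pow_of_le_one zero_le (by simp) h) 2
  have hδlim : Tendsto δ atTop (𝓝 0) := by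
    have := ((ENNReal.continuous_pow 2).tendsto 0).comp
      (ENNReal.tendsto_pow_atTop_nhds_zero_of_lt_one (r := 2⁻¹) (by simp))
    simpa [Function.comp_def] using this
  have hr : ∀ n : ℕ, ∃ r : ℝ, 0 < r ∧ r ≤ 1 / ((n : ℝ) + 1) ∧ S ≤ V r + δ n := by
    intro n
    have hn : (0 : ℝ) < 1 / ((n : ℝ) + 1) := by positivity
    rcases eq_or_ne S 0 with h0 | h0
    · exact ⟨_, hn, le_rfl, h0 ▸ zero_le⟩
    have := ENNReal.sub_lt_self hStop h0 (hδpos n)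
    rw [hS, lt_iSup_iff] at this
    obtain ⟨r, hr⟩ := this
    rw [lt_iSup_iff] at hr
    obtain ⟨hr0, hr⟩ := hr
    refine ⟨min r _, lt_min hr0 hn, min_le_right _ _, ?_⟩
    exact (tsub_le_iff_right.1 hr.le).trans (by gcongr; exact hVanti (min_le_left _ _))
  choose r hr0 hrn hrS using hr
  have hf : ∀ n : ℕ, ∃ f : (Fin d → ℝ) → ℝ, Measurable f ∧ 0 ≤ f ∧
      ∫⁻ x, ENNReal.ofReal (f x) ∂P = 1 ∧ Integrable (fun x => f x • x) P ∧
      ∫ x, f x • x ∂P ∈ Metric.closedBall a (r n) ∧ densityEnt P f ≤ S + δ n := by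
    intro n
    have hVS : V (r n) ≤ S := le_iSup₂ (f := fun r _ => V r) (r n) (hr0 n)
    have : V (r n) < S + δ n := hVS.trans_lt (ENNReal.lt_add_right hStop (hδpos n))
    simp only [hV, iInf_lt_iff] at this
    obtain ⟨x, hx, hlt⟩ := this
    obtain ⟨f, h1, h2, h3, h4, rfl, h6⟩ := exists_density_of_cramerRateRd_lt hlt
    exact ⟨f, h1, h2, h3, h4, hx, h6.le⟩
  choose f hf hf0 hf1 hfi hfa hfS using hf
  have hcauchy : ∀ N n m, N ≤ n → N ≤ m →
      eLpNorm ((fun x => √(f n x)) - fun x => √(f m x)) 2 P < 4 * 2⁻¹ ^ N := by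
    intro N n m hn hm
    have hmid : S ≤ densityEnt P (fun x => (f n x + f m x) / 2) + δ N := by
      have h1 := iInf_closedBall_le_densityEnt_midpoint (hf n) (hf0 n) (hf1 n) (hfi n)
        (Metric.closedBall_subset_closedBall (le_max_left (r n) (r m)) (hfa n))
        (hf m) (hf0 m) (hf1 m) (hfi m)
        (Metric.closedBall_subset_closedBall (le_max_right (r n) (r m)) (hfa m))
      refine le_trans ?_ (add_le_add_left h1 _)
      rcases max_choice (r n) (r m) with h | h <;> rw [h]
      · exact (hrS n).trans (add_le_add_right (hδanti hn) _)
      · exact (hrS m).trans (add_le_add_right (hδanti hm) _)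
    have hX := lintegral_sq_sqrt_sub_sqrt_le_densityEnt (P := P) (hf n) (hf0 n) (hf m) (hf0 m)
    have hX8 : ∫⁻ x, ‖√(f n x) - √(f m x)‖ₑ ^ 2 ∂P ≤ 8 * δ N := by
      refine (ENNReal.add_le_add_iff_right (a := 4 * S) (by finiteness)).1 ?_
      calc _ ≤ ∫⁻ x, ‖√(f n x) - √(f m x)‖ₑ ^ 2 ∂P +
            4 * (densityEnt P (fun x => (f n x + f m x) / 2) + δ N) := by gcongr
        _ ≤ 2 * densityEnt P (f n) + 2 * densityEnt P (f m) + 4 * δ N := by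
            rw [mul_add, ← add_assoc]; gcongr
        _ ≤ 2 * (S + δ N) + 2 * (S + δ N) + 4 * δ N := by
            gcongr
            · exact (hfS n).trans (add_le_add_right (hδanti hn) _)
            · exact (hfS m).trans (add_le_add_right (hδanti hm) _)
        _ = 8 * δ N + 4 * S := by ring
    rw [← ENNReal.rpow_lt_rpow_iff (z := 2) two_pos]
    rw [eLpNorm_eq_lintegral_rpow_enorm_toReal (by simp) (by simp)]
    rw [← ENNReal.rpow_mul]
    simp only [ENNReal.toReal_ofNat, Pi.sub_apply, one_div, ne_eq,
      OfNat.ofNat_ne_zero, not_false_eq_true, inv_mul_cancel₀, ENNReal.rpow_one,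
      ENNReal.rpow_ofNat]
    refine hX8.trans_lt ?_
    rw [mul_pow]
    refine ENNReal.mul_lt_mul_left (hδpos N) ((hδ1 N).trans_lt (by simp)).ne ?_
    norm_num
  have hsum : ∑' N : ℕ, (4 * 2⁻¹ ^ N : ℝ≥0∞) ≠ ⊤ := by
    rw [ENNReal.tsum_mul_left, ENNReal.tsum_geometric, ENNReal.one_sub_inv_two, inv_inv]
    finiteness
  have hlim := Lp.ae_tendsto_of_cauchy_eLpNorm (μ := P) (p := 2)
    (fun n => (hf n).sqrt.aestronglyMeasurable) (by norm_num) hsum hcauchy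
  obtain ⟨g, hg, hgl⟩ := measurable_limit_of_tendsto_metrizable_ae
    (fun n => (hf n).sqrt.aemeasurable) hlim
  have hle : cramerRateRd P a ≤ S := by
    refine cramerRateRd_le_of_tendsto_ae hP hf hf0 hf1 ?_ (b := fun n => S + δ n) ?_
      (M := S + 1) (by finiteness) (fun n => add_le_add_right (hδ1 n) _) hfS
      (hg.pow_const 2) (fun x => sq_nonneg _) ?_
    · rw [tendsto_iff_dist_tendsto_zero]
      exact squeeze_zero (fun _ => dist_nonneg) (fun n => (hfa n).trans (hrn n))
        tendsto_one_div_add_atTop_nhds_zero_nat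
    · simpa using tendsto_const_nhds.add hδlim
    · filter_upwards [hgl] with x hx
      have := hx.pow 2
      simpa only [Real.sq_sqrt (hf0 _ x)] using this
  exact absurd (hle.trans hSy) (not_le.2 hy)

end LowerSemicontinuity

section AverageMarginal

variable {α : Type*} [MeasurableSpace α] {n : ℕ}

/-- The average of the one-dimensional marginals of a measure on `Fin n → α`. -/
noncomputable def averageMarginal (ν : Measure (Fin n → α)) : Measure α :=
  (n : ℝ≥0∞)⁻¹ • ∑ i, ν.map (Function.eval i)

instance isProbabilityMeasure_averageMarginal (ν : Measure (Fin n → α)) [NeZero n]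
    [IsProbabilityMeasure ν] : IsProbabilityMeasure (averageMarginal ν) := by
  refine ⟨?_⟩
  have : ∀ i : Fin n, ν.map (Function.eval i) Set.univ = 1 := fun i => by
    rw [Measure.map_apply (measurable_pi_apply i) MeasurableSet.univ]
    simp
  simp only [averageMarginal, Measure.smul_apply, Measure.finsetSum_apply, this, smul_eq_mul]
  simpa using ENNReal.inv_mul_cancel (by simp [NeZero.ne n]) (by simp)

lemma integrable_averageMarginal_iff {F : Type*} [NormedAddCommGroup F] [NeZero n]
    {ν : Measure (Fin n → α)} {g : α → F} (hg : StronglyMeasurable g) :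
    Integrable g (averageMarginal ν) ↔ ∀ i, Integrable (fun x => g (x i)) ν := by
  rw [averageMarginal, integrable_smul_measure (by simp) (by simp [NeZero.ne n]),
    integrable_finsetSum_measure]
  simp only [Finset.mem_univ, true_imp_iff]
  exact forall_congr' fun i =>
    integrable_map_measure hg.aestronglyMeasurable (measurable_pi_apply i).aemeasurable

lemma integral_averageMarginal {F : Type*} [NormedAddCommGroup F] [NormedSpace ℝ F] [NeZero n]
    {ν : Measure (Fin n → α)} {g : α → F} (hg : StronglyMeasurable g)
    (hgi : Integrable g (averageMarginal ν)) :
    ∫ x, g x ∂(averageMarginal ν) = (n : ℝ)⁻¹ • ∫ x, ∑ i, g (x i) ∂ν := by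
  have h := (integrable_averageMarginal_iff hg).1 hgi
  rw [averageMarginal, integral_smul_measure, integral_finsetSum_measure,
    integral_finsetSum _ fun i _ => h i]
  · simp only [ENNReal.toReal_inv, ENNReal.toReal_natCast]
    congr 1
    refine Finset.sum_congr rfl fun i _ => ?_
    exact integral_map (measurable_pi_apply i).aemeasurable hg.aestronglyMeasurable
  · exact fun i _ => (integrable_map_measure hg.aestronglyMeasurable
      (measurable_pi_apply i).aemeasurable).2 (h i)

lemma map_eval_absolutelyContinuous_averageMarginal (ν : Measure (Fin n → α)) (i : Fin n) :
    ν.map (Function.eval i) ≪ averageMarginal ν := by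
  refine Measure.AbsolutelyContinuous.smul_right ?_ (by simp)
  exact Measure.absolutelyContinuous_of_le
    (Finset.single_le_sum (f := fun i => ν.map (Function.eval i)) (fun _ _ => Measure.zero_le _)
      (Finset.mem_univ i))

lemma averageMarginal_le_smul {P : Measure α} [IsProbabilityMeasure P]
    {ν : Measure (Fin n → α)} [NeZero n] {c : ℝ≥0∞}
    (h : ν ≤ c • Measure.pi fun _ => P) : averageMarginal ν ≤ c • P := by
  refine Measure.le_iff.2 fun s hs => ?_
  have : ∀ i : Fin n, ν.map (Function.eval i) s ≤ c * P s := fun i => by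
    rw [Measure.map_apply (measurable_pi_apply i) hs]
    refine (h _).trans_eq ?_
    rw [Measure.smul_apply, smul_eq_mul,
      (measurePreserving_eval (fun _ : Fin n => P) i).measure_preimage hs.nullMeasurableSet]
  simp only [averageMarginal, Measure.smul_apply, Measure.finsetSum_apply, smul_eq_mul]
  calc (n : ℝ≥0∞)⁻¹ * ∑ i : Fin n, ν.map (Function.eval i) s
      ≤ (n : ℝ≥0∞)⁻¹ * ∑ i : Fin n, c * P s := by gcongr with i; exact this i
    _ = c * P s := by
      rw [Finset.sum_const, Finset.card_univ, Fintype.card_fin, nsmul_eq_mul, ← mul_assoc,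
        ENNReal.inv_mul_cancel (by simp [NeZero.ne n]) (by simp), one_mul]

lemma lintegral_pi_prod (P : Measure α) [IsProbabilityMeasure P] {f : Fin n → α → ℝ≥0∞}
    (hf : ∀ i, Measurable (f i)) :
    ∫⁻ x : Fin n → α, ∏ i, f i (x i) ∂(Measure.pi fun _ => P) = ∏ i, ∫⁻ x, f i x ∂P := by
  have h := lintegral_prod_eq_prod_lintegral_of_indepFun (μ := Measure.pi fun _ : Fin n => P)
    Finset.univ (fun i (x : Fin n → α) => f i (x i))
    (iIndepFun_pi (X := f) fun i => (hf i).aemeasurable) (fun i => by fun_prop)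
  simpa only [show ∀ i : Fin n, ∫⁻ x : Fin n → α, f i (x i) ∂(Measure.pi fun _ => P) =
    ∫⁻ x, f i x ∂P from fun i =>
      (measurePreserving_eval (fun _ : Fin n => P) i).lintegral_comp (hf i)] using h

lemma klDiv_ne_top_of_le_smul {Q P : Measure α} [IsProbabilityMeasure P] [IsProbabilityMeasure Q]
    {c : ℝ≥0∞} (hc : c ≠ ⊤) (h : Q ≤ c • P) : klDiv Q P ≠ ⊤ := by
  have hQP : Q ≪ P := (Measure.absolutelyContinuous_of_le h).trans
    (Measure.smul_absolutelyContinuous)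
  have hle : Q.rnDeriv P ≤ᵐ[P] fun _ => c := by
    refine ae_le_of_forall_setLIntegral_le_of_sigmaFinite (Measure.measurable_rnDeriv _ _)
      fun s _ _ => ?_
    rw [setLIntegral_const]
    exact (Measure.setLIntegral_rnDeriv_le s).trans (h s)
  rw [klDiv_eq_lintegral_klFun_of_ac hQP]
  refine ((lintegral_mono_ae (g := fun _ => ENNReal.ofReal (c.toReal * c.toReal + 1))
    ?_).trans_lt (by simp)).ne
  filter_upwards [hle] with x hx
  refine ENNReal.ofReal_le_ofReal ?_
  have h0 : 0 ≤ (Q.rnDeriv P x).toReal := ENNReal.toReal_nonneg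
  have h1 : (Q.rnDeriv P x).toReal ≤ c.toReal := ENNReal.toReal_mono hc hx
  have h2 := mul_le_mul_of_nonneg_left (Real.log_le_self h0) h0
  rw [klFun_apply]
  nlinarith

lemma ofReal_exp_llr_ae_eq {Q P : Measure α} [SigmaFinite Q] [SigmaFinite P] (hQP : Q ≪ P) :
    ∀ᵐ x ∂Q, ENNReal.ofReal (Real.exp (llr Q P x)) = Q.rnDeriv P x := by
  filter_upwards [exp_llr_of_ac Q P hQP, hQP.ae_le (Q.rnDeriv_lt_top P)] with x hx hx'
  rw [hx, ENNReal.ofReal_toReal hx'.ne]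

/-- If `ν` has density at most `c` with respect to `P ^ n`, then the average marginal of `ν` has
relative entropy at most `log c / n` with respect to `P`. -/
lemma exp_mul_integral_llr_averageMarginal_le {P : Measure α} [IsProbabilityMeasure P] [NeZero n]
    {ν : Measure (Fin n → α)} [IsProbabilityMeasure ν] {c : ℝ≥0∞} (hc : c ≠ ⊤)
    (h : ν ≤ c • Measure.pi fun _ => P) :
    Real.exp (n * ∫ x, llr (averageMarginal ν) P x ∂(averageMarginal ν)) ≤ c.toReal := by
  set Q := averageMarginal ν with hQ
  obtain ⟨hQP, hint⟩ := klDiv_ne_top_iff.1 (klDiv_ne_top_of_le_smul hc (averageMarginal_le_smul h))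
  have hllr := stronglyMeasurable_llr Q P
  have hsum : Integrable (fun x : Fin n → α => ∑ i, llr Q P (x i)) ν :=
    integrable_finsetSum _ fun i _ => (integrable_averageMarginal_iff hllr).1 hint i
  have hae : (fun x : Fin n → α => ENNReal.ofReal (Real.exp (∑ i, llr Q P (x i)))) =ᵐ[ν]
      fun x => ∏ i, Q.rnDeriv P (x i) := by
    have : ∀ i : Fin n, ∀ᵐ x ∂ν, ENNReal.ofReal (Real.exp (llr Q P (x i))) =
        Q.rnDeriv P (x i) := fun i =>
      ae_of_ae_map (measurable_pi_apply i).aemeasurable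
        ((map_eval_absolutelyContinuous_averageMarginal ν i).ae_le (ofReal_exp_llr_ae_eq hQP))
    filter_upwards [ae_all_iff.2 this] with x hx
    rw [Real.exp_sum, ENNReal.ofReal_prod_of_nonneg fun _ _ => Real.exp_nonneg _]
    exact Finset.prod_congr rfl fun i _ => hx i
  have hle : ∫⁻ x, ENNReal.ofReal (Real.exp (∑ i, llr Q P (x i))) ∂ν ≤ c := by
    rw [lintegral_congr_ae hae]
    refine (lintegral_mono' h le_rfl).trans ?_
    rw [lintegral_smul_measure, lintegral_pi_prod P fun _ => Measure.measurable_rnDeriv Q P,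
      Finset.prod_const, Measure.lintegral_rnDeriv hQP, measure_univ, one_pow, smul_eq_mul,
      mul_one]
  have hmeas : Measurable fun x : Fin n → α => Real.exp (∑ i, llr Q P (x i)) := by
    have := hllr.measurable
    fun_prop
  have hexp : Integrable (fun x : Fin n → α => Real.exp (∑ i, llr Q P (x i))) ν :=
    (lintegral_ofReal_ne_top_iff_integrable hmeas.aestronglyMeasurable
      (ae_of_all _ fun _ => Real.exp_nonneg _)).1 (hle.trans_lt hc.lt_top).ne
  rw [integral_averageMarginal hllr hint, smul_eq_mul, mul_inv_cancel_left₀ (by simp [NeZero.ne n])]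
  refine (convexOn_exp.map_integral_le Real.continuous_exp.continuousOn isClosed_univ (by simp)
    hsum hexp).trans ?_
  rw [integral_eq_lintegral_of_nonneg_ae (ae_of_all _ fun _ => Real.exp_nonneg _)
    hmeas.aestronglyMeasurable]
  exact ENNReal.toReal_mono hc hle

end AverageMarginal

section UpperBound

variable {d : ℕ} {P : Measure (Fin d → ℝ)} [IsProbabilityMeasure P]

lemma measurable_sampleMean (n : ℕ) :
    Measurable fun x : Fin n → (Fin d → ℝ) => (n : ℝ)⁻¹ • ∑ i, x i := by fun_prop

/-- Nonasymptotic Cramér bound for closed convex sets. -/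
lemma sampleMeanLawRd_le_exp_of_convex (hPi : Integrable (fun x => x) P) {C : Set (Fin d → ℝ)}
    (hC : IsClosed C) (hconv : Convex ℝ C) {L : ℝ}
    (hL : ∀ x ∈ C, ENNReal.ofReal L ≤ cramerRateRd P x) (n : ℕ) [NeZero n] :
    sampleMeanLawRd P n C ≤ ENNReal.ofReal (Real.exp (-(n * L))) := by
  rw [sampleMeanLawRd, Measure.map_apply (measurable_sampleMean n) hC.measurableSet]
  set μ := Measure.pi fun _ : Fin n => P with hμ
  set A := (fun x : Fin n → (Fin d → ℝ) => (n : ℝ)⁻¹ • ∑ i, x i) ⁻¹' C with hA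
  have hAm : MeasurableSet A := measurable_sampleMean n hC.measurableSet
  rcases eq_or_ne (μ A) 0 with h0 | h0
  · rw [h0]; exact zero_le
  have hR := cond_isProbabilityMeasure h0
  have hcR : (μ A)⁻¹ ≠ ⊤ := ENNReal.inv_ne_top.2 h0
  have hRle : ProbabilityTheory.cond μ A ≤ (μ A)⁻¹ • Measure.pi fun _ => P := by
    rw [ProbabilityTheory.cond]
    gcongr
    exact Measure.restrict_le_self
  have hQle := averageMarginal_le_smul hRle
  set Q := averageMarginal (ProbabilityTheory.cond μ A) with hQ
  obtain ⟨hQP, hint⟩ := klDiv_ne_top_iff.1 (klDiv_ne_top_of_le_smul hcR hQle)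
  have hQi : Integrable (fun x : Fin d → ℝ => x) Q :=
    (hPi.smul_measure hcR).mono_measure hQle
  have hmean : ∫ y, y ∂Q ∈ C := by
    rw [integral_averageMarginal (g := fun x => x) stronglyMeasurable_id hQi, ← integral_smul]
    refine hconv.integral_mem hC ?_ ((integrable_finsetSum _ fun i _ =>
      (integrable_averageMarginal_iff stronglyMeasurable_id).1 hQi i).smul (n : ℝ)⁻¹)
    exact ae_cond_mem hAm
  have hle : ENNReal.ofReal L ≤ relEnt Q P := (hL _ hmean).trans
    (iInf₂_le_of_le Q inferInstance (iInf₂_le_of_le hQi rfl le_rfl))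
  have hexp := exp_mul_integral_llr_averageMarginal_le hcR hRle
  rw [← hQ] at hexp
  have hnonneg : 0 ≤ ∫ x, llr Q P x ∂Q := by
    simpa using integral_llr_add_sub_measure_univ_nonneg hQP hint
  rw [relEnt, if_pos ⟨hQP, hint⟩, ENNReal.ofReal_le_ofReal_iff hnonneg] at hle
  have h1 : Real.exp (n * L) ≤ (μ A)⁻¹.toReal := (Real.exp_le_exp.2 (by gcongr)).trans hexp
  rw [ENNReal.toReal_inv] at h1
  rw [Real.exp_neg, ← ENNReal.ofReal_toReal (measure_ne_top μ A)]
  refine ENNReal.ofReal_le_ofReal ?_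
  rw [le_inv_comm₀ (ENNReal.toReal_pos h0 (measure_ne_top μ A)) (Real.exp_pos _)]
  exact h1

end UpperBound

section NegLogRate

lemma negLogRate_antitone (n : ℕ) : Antitone (negLogRate n) := by
  intro p q hpq
  simp only [negLogRate, EReal.neg_mul]
  exact EReal.neg_le_neg_iff.2 (mul_le_mul_of_nonneg_left (ENNReal.log_monotone hpq)
    (EReal.coe_nonneg.2 (by positivity)))

lemma negLogRate_ofReal_exp (n : ℕ) [NeZero n] (a : ℝ) :
    negLogRate n (ENNReal.ofReal (Real.exp (-(n * a)))) = a := by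
  have hn : (n : ℝ) ≠ 0 := by simp [NeZero.ne n]
  rw [negLogRate, ENNReal.log_ofReal_of_pos (Real.exp_pos _), Real.log_exp]
  norm_cast
  field_simp

lemma coe_le_liminf_negLogRate {p : ℕ → ℝ≥0∞} {N : ℕ} {L : ℝ}
    (h : ∀ n, n ≠ 0 → p n ≤ N * ENNReal.ofReal (Real.exp (-(n * L)))) :
    (L : EReal) ≤ liminf (fun n => negLogRate n (p n)) atTop := by
  refine le_of_forall_lt fun c hc => ?_
  obtain ⟨b, hcb, hbL⟩ := EReal.lt_iff_exists_real_btwn.1 hc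
  refine hcb.trans_le (le_liminf_of_le (by isBoundedDefault) ?_)
  have hb : 0 < L - b := sub_pos.2 (EReal.coe_lt_coe_iff.1 hbL)
  have htend : Tendsto (fun n : ℕ => Real.exp (n * (L - b))) atTop atTop :=
    Real.tendsto_exp_atTop.comp (tendsto_natCast_atTop_atTop.atTop_mul_const hb)
  filter_upwards [htend.eventually_ge_atTop (N : ℝ), eventually_ne_atTop 0] with n hn hn0
  have : NeZero n := ⟨hn0⟩
  rw [← negLogRate_ofReal_exp n b]
  refine negLogRate_antitone n ((h n hn0).trans ?_)
  rw [← ENNReal.ofReal_natCast, ← ENNReal.ofReal_mul (by positivity)]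
  refine ENNReal.ofReal_le_ofReal ?_
  calc (N : ℝ) * Real.exp (-(n * L))
      ≤ Real.exp (n * (L - b)) * Real.exp (-(n * L)) := by gcongr
    _ = Real.exp (-(n * b)) := by rw [← Real.exp_add]; ring_nf

lemma limsup_negLogRate_le_coe {p : ℕ → ℝ≥0∞} {L : ℝ}
    (h : ∀ᶠ n : ℕ in atTop, ENNReal.ofReal (Real.exp (-(n * L))) ≤ p n) :
    limsup (fun n => negLogRate n (p n)) atTop ≤ L := by
  refine limsup_le_of_le (by isBoundedDefault) ?_
  filter_upwards [h, eventually_ne_atTop 0] with n hn hn0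
  have : NeZero n := ⟨hn0⟩
  rw [← negLogRate_ofReal_exp n L]
  exact negLogRate_antitone n hn

end NegLogRate

section ClosedSets

/-- `μ n s` decays exponentially at rate at least `L`, up to a multiplicative constant. -/
def HasExpBound {α : Type*} [MeasurableSpace α] (μ : ℕ → Measure α) (L : ℝ) (s : Set α) : Prop :=
  ∃ N : ℕ, ∀ n, n ≠ 0 → μ n s ≤ N * ENNReal.ofReal (Real.exp (-(n * L)))

namespace HasExpBound

variable {α : Type*} [MeasurableSpace α] {μ : ℕ → Measure α} {L : ℝ} {s t : Set α}

lemma empty : HasExpBound μ L ∅ := ⟨0, by simp⟩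

lemma mono (hst : s ⊆ t) : HasExpBound μ L t → HasExpBound μ L s := fun ⟨N, hN⟩ =>
  ⟨N, fun n hn => (measure_mono hst).trans (hN n hn)⟩

lemma union : HasExpBound μ L s → HasExpBound μ L t → HasExpBound μ L (s ∪ t) :=
  fun ⟨N, hN⟩ ⟨M, hM⟩ => ⟨N + M, fun n hn => (measure_union_le s t).trans (by
    rw [Nat.cast_add, add_mul]
    exact add_le_add (hN n hn) (hM n hn))⟩

lemma iUnion {ι : Type*} [Fintype ι] {s : ι → Set α} (h : ∀ i, HasExpBound μ L (s i)) :
    HasExpBound μ L (⋃ i, s i) := by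
  choose N hN using h
  refine ⟨∑ i, N i, fun n hn => (measure_iUnion_fintype_le _ _).trans ?_⟩
  rw [Nat.cast_sum, Finset.sum_mul]
  exact Finset.sum_le_sum fun i _ => hN i n hn

end HasExpBound

variable {d : ℕ} {P : Measure (Fin d → ℝ)} [IsProbabilityMeasure P]

lemma hasExpBound_of_convex (hPi : Integrable (fun x => x) P) {C : Set (Fin d → ℝ)}
    (hC : IsClosed C) (hconv : Convex ℝ C) {L : ℝ}
    (hL : ∀ x ∈ C, ENNReal.ofReal L ≤ cramerRateRd P x) :
    HasExpBound (sampleMeanLawRd P) L C :=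
  ⟨1, fun n hn => by
    have : NeZero n := ⟨hn⟩
    simpa using sampleMeanLawRd_le_exp_of_convex hPi hC hconv hL n⟩

/-- The rate function is coercive. -/
lemma exists_forall_le_cramerRateRd (hP : Integrable (fun x => Real.exp (1 * ‖x‖)) P) (L : ℝ) :
    ∃ r : ℝ, 0 < r ∧ ∀ x, r ≤ ‖x‖ → ENNReal.ofReal L ≤ cramerRateRd P x := by
  have hM := hP.lintegral_lt_top
  set M := ∫⁻ x, ENNReal.ofReal (Real.exp (1 * ‖x‖)) ∂P
  refine ⟨(ENNReal.ofReal L + M).toReal + 1, by positivity, fun x hx => ?_⟩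
  by_contra! hlt
  obtain ⟨f, hf, hf0, -, -, rfl, hent⟩ := exists_density_of_cramerRateRd_lt hlt
  have h : ‖∫ x, f x • x ∂P‖ₑ ≤ ENNReal.ofReal L + M := by
    refine (enorm_integral_le_lintegral_enorm _).trans ?_
    have := setLIntegral_enorm_smul_le (P := P) (φ := fun x => x) hf hf0 Set.univ one_pos
    rw [Measure.restrict_univ, inv_one, ENNReal.ofReal_one, one_mul] at this
    refine this.trans ?_
    gcongr
  have h' := ENNReal.toReal_mono (ENNReal.add_lt_top.2 ⟨ENNReal.ofReal_lt_top, hM⟩).ne h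
  rw [toReal_enorm] at h'
  linarith

lemma hasExpBound_of_le_norm (hPi : Integrable (fun x => x) P) {L r : ℝ} (hr : 0 < r)
    (hL : ∀ x, r ≤ ‖x‖ → ENNReal.ofReal L ≤ cramerRateRd P x) :
    HasExpBound (sampleMeanLawRd P) L {x | r ≤ ‖x‖} := by
  have hcover : {x : Fin d → ℝ | r ≤ ‖x‖} ⊆ ⋃ j : Fin d, {x | r ≤ x j} ∪ {x | x j ≤ -r} := by
    intro x hx
    by_contra! hcon
    simp only [Set.mem_iUnion, Set.mem_union, Set.mem_ofPred_eq, not_exists, not_or, not_le] at hcon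
    exact (show r ≤ ‖x‖ from hx).not_gt
      ((pi_norm_lt_iff hr).2 fun j => abs_lt.2 ⟨(hcon j).2, (hcon j).1⟩)
  refine (HasExpBound.iUnion fun j => ?_).mono hcover
  refine (hasExpBound_of_convex hPi (isClosed_le continuous_const (continuous_apply j))
    (convex_halfSpace_ge (LinearMap.proj j).isLinear r) fun x hx => hL x ?_).union
    (hasExpBound_of_convex hPi (isClosed_le (continuous_apply j) continuous_const)
    (convex_halfSpace_le (LinearMap.proj j).isLinear (-r)) fun x hx => hL x ?_)
  · exact (le_trans hx (le_abs_self _)).trans (norm_le_pi_norm x j)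
  · exact ((le_neg_of_le_neg hx).trans (neg_le_abs _)).trans (norm_le_pi_norm x j)

lemma hasExpBound_of_isClosed (hP : ∀ c : ℝ, Integrable (fun x => Real.exp (c * ‖x‖)) P)
    {F : Set (Fin d → ℝ)} (hF : IsClosed F) {L : ℝ}
    (hL : ∀ x ∈ F, ENNReal.ofReal L < cramerRateRd P x) :
    HasExpBound (sampleMeanLawRd P) L F := by
  have hPi : Integrable (fun x => x) P := (hP 1).mono' (by fun_prop) (ae_of_all _ fun x => by
    have := Real.add_one_le_exp (1 * ‖x‖)
    linarith)
  obtain ⟨r, hr, hrL⟩ := exists_forall_le_cramerRateRd (hP 1) L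
  have hK : HasExpBound (sampleMeanLawRd P) L (F ∩ Metric.closedBall 0 r) := by
    refine ((isCompact_closedBall 0 r).inter_left hF).induction_on HasExpBound.empty
      (fun _ _ => HasExpBound.mono) (fun _ _ => HasExpBound.union) fun x hx => ?_
    obtain ⟨δ, hδ, hball⟩ := Metric.nhds_basis_closedBall.eventually_iff.1
      (lowerSemicontinuous_cramerRateRd hP x _ (hL x hx.1))
    exact ⟨Metric.closedBall x δ, mem_nhdsWithin_of_mem_nhds (Metric.closedBall_mem_nhds x hδ),
      hasExpBound_of_convex hPi Metric.isClosed_closedBall (convex_closedBall x δ)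
        fun y hy => (hball hy).le⟩
  refine (hK.union (hasExpBound_of_le_norm hPi hr hrL)).mono fun x hx => ?_
  rcases le_total r ‖x‖ with h | h
  · exact Or.inr h
  · exact Or.inl ⟨hx, by simpa using h⟩

theorem iInf_cramerRateRd_le_liminf (hP : ∀ c : ℝ, Integrable (fun x => Real.exp (c * ‖x‖)) P)
    {F : Set (Fin d → ℝ)} (hF : IsClosed F) :
    ((⨅ x ∈ F, cramerRateRd P x : ℝ≥0∞) : EReal)
      ≤ liminf (fun n : ℕ => negLogRate n (sampleMeanLawRd P n F)) atTop := by
  refine le_of_forall_lt fun c hc => ?_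
  obtain ⟨L, hcL, hL⟩ := EReal.lt_iff_exists_real_btwn.1 hc
  refine hcL.trans_le ?_
  rcases lt_or_ge L 0 with h0 | h0
  · refine (EReal.coe_le_coe h0.le).trans (coe_le_liminf_negLogRate (N := 1) fun n _ => ?_)
    have : IsProbabilityMeasure (sampleMeanLawRd P n) :=
      Measure.isProbabilityMeasure_map (measurable_sampleMean n).aemeasurable
    simpa using prob_le_one
  · have hlt : ENNReal.ofReal L < ⨅ x ∈ F, cramerRateRd P x := by
      rw [← EReal.coe_ennreal_lt_coe_ennreal_iff]
      rwa [EReal.coe_ennreal_ofReal, max_eq_left h0]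
    obtain ⟨N, hN⟩ := hasExpBound_of_isClosed hP hF
      fun x hx => hlt.trans_le (iInf₂_le x hx)
    exact coe_le_liminf_negLogRate hN

end ClosedSets

section OpenSets

variable {α : Type*} [MeasurableSpace α] {P Q : Measure α} [IsProbabilityMeasure P]
  [IsProbabilityMeasure Q]

lemma pi_eq_withDensity_prod_rnDeriv (hQP : Q ≪ P) (n : ℕ) :
    (Measure.pi fun _ : Fin n => Q) =
      (Measure.pi fun _ => P).withDensity fun x => ∏ i, Q.rnDeriv P (x i) := by
  refine Measure.pi_eq fun s hs => ?_
  have hind : ((Set.univ.pi s).indicator fun x : Fin n → α => ∏ i, Q.rnDeriv P (x i)) =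
      fun x => ∏ i, (s i).indicator (Q.rnDeriv P) (x i) := by
    ext x
    by_cases hx : ∀ i, x i ∈ s i
    · rw [Set.indicator_of_mem (Set.mem_univ_pi.2 hx)]
      exact Finset.prod_congr rfl fun i _ => (Set.indicator_of_mem (hx i) _).symm
    · rw [Set.indicator_of_notMem (Set.mem_univ_pi.not.2 hx)]
      obtain ⟨i, hi⟩ := not_forall.1 hx
      exact (Finset.prod_eq_zero (Finset.mem_univ i) (Set.indicator_of_notMem hi _)).symm
  rw [withDensity_apply _ (.univ_pi hs), ← lintegral_indicator (.univ_pi hs), hind,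
    lintegral_pi_prod P fun i => (Measure.measurable_rnDeriv Q P).indicator (hs i)]
  refine Finset.prod_congr rfl fun i _ => ?_
  rw [lintegral_indicator (hs i)]
  exact Measure.setLIntegral_rnDeriv hQP _

lemma pi_le_ofReal_exp_mul_pi (hQP : Q ≪ P) {n : ℕ} {A : Set (Fin n → α)} (hA : MeasurableSet A)
    {b : ℝ} (hb : ∀ x ∈ A, ∑ i, llr Q P (x i) ≤ b) :
    Measure.pi (fun _ => Q) A ≤ ENNReal.ofReal (Real.exp b) * Measure.pi (fun _ => P) A := by
  have hae : ∀ i : Fin n, ∀ᵐ x ∂(Measure.pi fun _ : Fin n => P),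
      Q.rnDeriv P (x i) ≤ ENNReal.ofReal (Real.exp (llr Q P (x i))) := fun i =>
    (measurePreserving_eval (fun _ : Fin n => P) i).quasiMeasurePreserving.ae
      ((Q.rnDeriv_lt_top P).mono fun x hx =>
        (ENNReal.le_ofReal_iff_toReal_le hx.ne (Real.exp_nonneg _)).2 (Real.le_exp_log _))
  rw [pi_eq_withDensity_prod_rnDeriv hQP, withDensity_apply _ hA, ← setLIntegral_const]
  refine setLIntegral_mono_ae (by fun_prop) ?_
  filter_upwards [ae_all_iff.2 hae] with x hx hxA
  calc ∏ i, Q.rnDeriv P (x i)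
      ≤ ∏ i, ENNReal.ofReal (Real.exp (llr Q P (x i))) := Finset.prod_le_prod' fun i _ => hx i
    _ = ENNReal.ofReal (Real.exp (∑ i, llr Q P (x i))) := by
      rw [Real.exp_sum, ENNReal.ofReal_prod_of_nonneg fun _ _ => Real.exp_nonneg _]
    _ ≤ ENNReal.ofReal (Real.exp b) := by
      gcongr
      exact hb x hxA

/-- A weak law of large numbers on finite product spaces. -/
lemma tendsto_pi_mean_mem {F : Type*} [NormedAddCommGroup F] [NormedSpace ℝ F] [CompleteSpace F]
    [MeasurableSpace F] [BorelSpace F] [SecondCountableTopology F] {Y : α → F}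
    (hY : Measurable Y) (hYi : Integrable Y Q) {U : Set F} (hU : IsOpen U)
    (hmem : ∫ x, Y x ∂Q ∈ U) :
    Tendsto (fun n : ℕ => Measure.pi (fun _ : Fin n => Q)
      {x | (n : ℝ)⁻¹ • ∑ i, Y (x i) ∈ U}) atTop (𝓝 1) := by
  set μ := Measure.infinitePi fun _ : ℕ => Q
  have heval : ∀ i : ℕ, MeasurePreserving (fun ω : ℕ → α => ω i) μ Q :=
    measurePreserving_eval_infinitePi fun _ : ℕ => Q
  have hint : Integrable (fun ω : ℕ → α => Y (ω 0)) μ := (heval 0).integrable_comp_of_integrable hYi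
  have hindep : iIndepFun (fun (i : ℕ) (ω : ℕ → α) => Y (ω i)) μ :=
    iIndepFun_infinitePi (X := fun _ => Y) fun _ => hY
  have hident : ∀ i : ℕ, IdentDistrib (fun ω : ℕ → α => Y (ω i)) (fun ω => Y (ω 0)) μ μ :=
    fun i => IdentDistrib.comp (u := Y) ⟨(heval i).aemeasurable, (heval 0).aemeasurable,
      (heval i).map_eq.trans (heval 0).map_eq.symm⟩ hY
  have hmean : ∫ ω, Y (ω 0) ∂μ = ∫ x, Y x ∂Q := by
    rw [← (heval 0).map_eq, integral_map (heval 0).aemeasurable hY.aestronglyMeasurable]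
  have hlln := strong_law_ae (μ := μ) (fun i ω => Y (ω i)) hint
    (fun i j hij => hindep.indepFun hij) hident
  have hmeas : ∀ n : ℕ, MeasurableSet {x : Fin n → α | (n : ℝ)⁻¹ • ∑ i, Y (x i) ∈ U} := fun n =>
    hU.measurableSet.preimage (f := fun x : Fin n → α => (n : ℝ)⁻¹ • ∑ i, Y (x i)) (by fun_prop)
  have hproj : ∀ n : ℕ, Measurable fun (ω : ℕ → α) (i : Fin n) => ω i := fun n => by fun_prop
  have h := tendsto_measure_of_ae_tendsto_indicator_of_isFiniteMeasure (μ := μ) atTop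
    MeasurableSet.univ (fun n => hproj n (hmeas n)) (by
      filter_upwards [hlln] with ω hω
      rw [hmean] at hω
      filter_upwards [hω (hU.mem_nhds hmem)] with n hn
      simpa [Finset.sum_range] using hn)
  rw [measure_univ] at h
  refine h.congr fun n => ?_
  rw [← Measure.map_apply (hproj n) (hmeas n),
    Measure.map_infinitePi_infinitePi_of_inj (P := fun _ : ℕ => Q) (f := fun i : Fin n => (i : ℕ))
      Fin.val_injective, Measure.infinitePi_eq_pi]

variable {d : ℕ} {P : Measure (Fin d → ℝ)} [IsProbabilityMeasure P]

lemma limsup_negLogRate_le_relEnt {Q : Measure (Fin d → ℝ)} [IsProbabilityMeasure Q]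
    (hQi : Integrable (fun y => y) Q) {G : Set (Fin d → ℝ)} (hG : IsOpen G)
    (hmem : ∫ y, y ∂Q ∈ G) :
    limsup (fun n : ℕ => negLogRate n (sampleMeanLawRd P n G)) atTop ≤ (relEnt Q P : EReal) := by
  by_cases hfin : Q ≪ P ∧ Integrable (llr Q P) Q
  swap
  · simp [relEnt, hfin]
  obtain ⟨hQP, hint⟩ := hfin
  have hnonneg : 0 ≤ ∫ x, llr Q P x ∂Q := by
    simpa using integral_llr_add_sub_measure_univ_nonneg hQP hint
  rw [relEnt, if_pos ⟨hQP, hint⟩, EReal.coe_ennreal_ofReal, max_eq_left hnonneg]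
  refine le_of_forall_gt fun c hc => ?_
  obtain ⟨b, hb, hbc⟩ := EReal.lt_iff_exists_real_btwn.1 hc
  obtain ⟨a, ha, hab⟩ := exists_between (EReal.coe_lt_coe_iff.1 hb)
  refine (limsup_negLogRate_le_coe ?_).trans_lt hbc
  have hllr := (stronglyMeasurable_llr Q P).measurable
  have hY : Measurable fun x : Fin d → ℝ => (x, llr Q P x) := measurable_id.prodMk hllr
  have hlim := tendsto_pi_mean_mem hY (hQi.prodMk hint) (hG.prod (isOpen_Iio (a := a)))
    (by rw [integral_pair hQi hint]; exact ⟨hmem, ha⟩)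
  have hexp : Tendsto (fun n : ℕ => Real.exp (-(n * (b - a)))) atTop (𝓝 0) :=
    Real.tendsto_exp_neg_atTop_nhds_zero.comp
      (tendsto_natCast_atTop_atTop.atTop_mul_const (sub_pos.2 hab))
  have hexp' := ENNReal.tendsto_ofReal hexp
  rw [ENNReal.ofReal_zero] at hexp'
  filter_upwards [hexp'.eventually_lt hlim zero_lt_one, eventually_gt_atTop 0] with n hn hn0
  set A := {x : Fin n → (Fin d → ℝ) |
    (n : ℝ)⁻¹ • ∑ i, (x i, llr Q P (x i)) ∈ G ×ˢ Set.Iio a} with hA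
  have hAm : MeasurableSet A :=
    (hG.prod isOpen_Iio).measurableSet.preimage
      (f := fun x : Fin n → (Fin d → ℝ) => (n : ℝ)⁻¹ • ∑ i, (x i, llr Q P (x i))) (by fun_prop)
  have hn0' : (0 : ℝ) < n := by exact_mod_cast hn0
  have hAG : A ⊆ (fun x : Fin n → (Fin d → ℝ) => (n : ℝ)⁻¹ • ∑ i, x i) ⁻¹' G := fun x hx => by
    simpa [Prod.fst_sum] using hx.1
  have hAllr : ∀ x ∈ A, ∑ i, llr Q P (x i) ≤ n * a := fun x hx => by
    have h : (n : ℝ)⁻¹ * ∑ i, llr Q P (x i) < a := by simpa [Prod.snd_sum] using hx.2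
    exact ((inv_mul_lt_iff₀ hn0').1 h).le
  rw [sampleMeanLawRd, Measure.map_apply (measurable_sampleMean n) hG.measurableSet]
  refine le_trans ?_ (measure_mono hAG)
  have h := hn.le.trans (pi_le_ofReal_exp_mul_pi hQP hAm hAllr)
  calc ENNReal.ofReal (Real.exp (-(n * b)))
      = ENNReal.ofReal (Real.exp (-(n * a))) * ENNReal.ofReal (Real.exp (-(n * (b - a)))) := by
        rw [← ENNReal.ofReal_mul (Real.exp_nonneg _), ← Real.exp_add]
        ring_nf
    _ ≤ ENNReal.ofReal (Real.exp (-(n * a))) * (ENNReal.ofReal (Real.exp (n * a)) *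
        Measure.pi (fun _ => P) A) := by gcongr
    _ = Measure.pi (fun _ => P) A := by
        rw [← mul_assoc, ← ENNReal.ofReal_mul (Real.exp_nonneg _), ← Real.exp_add]
        simp

theorem limsup_le_iInf_cramerRateRd {G : Set (Fin d → ℝ)} (hG : IsOpen G) :
    limsup (fun n : ℕ => negLogRate n (sampleMeanLawRd P n G)) atTop
      ≤ ((⨅ x ∈ G, cramerRateRd P x : ℝ≥0∞) : EReal) := by
  by_contra! hlt
  set l := limsup (fun n : ℕ => negLogRate n (sampleMeanLawRd P n G)) atTop
  have hl0 : (l.toENNReal : EReal) = l :=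
    EReal.coe_toENNReal ((EReal.coe_ennreal_nonneg _).trans hlt.le)
  rw [← hl0, EReal.coe_ennreal_lt_coe_ennreal_iff] at hlt
  simp only [cramerRateRd, iInf_lt_iff] at hlt
  obtain ⟨x, hx, Q, hQ, hQi, rfl, h⟩ := hlt
  rw [← EReal.coe_ennreal_lt_coe_ennreal_iff, hl0] at h
  exact h.not_ge (limsup_negLogRate_le_relEnt hQi hG hx)

end OpenSets

/-- **Cramér's theorem for `ℝ^d`.** If all exponential moments of `P` are finite, the laws of
the sample means satisfy the large deviation lower bound on closed sets and upper bound on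
open sets, with rate function `γ(α) = inf { D(Q‖P) : E_Q[X] = α }`. -/
theorem cramer_Rd {d : ℕ} (P : Measure (Fin d → ℝ)) [IsProbabilityMeasure P]
    (hΛ : ∀ l : Fin d → ℝ,
      ∫⁻ x, ENNReal.ofReal (Real.exp (∑ j, l j * x j)) ∂P < ⊤) :
    (∀ F : Set (Fin d → ℝ), IsClosed F →
      ((⨅ x ∈ F, cramerRateRd P x : ℝ≥0∞) : EReal)
        ≤ liminf (fun n : ℕ => negLogRate n (sampleMeanLawRd P n F)) atTop)
    ∧ (∀ G : Set (Fin d → ℝ), IsOpen G →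
      limsup (fun n : ℕ => negLogRate n (sampleMeanLawRd P n G)) atTop
        ≤ ((⨅ x ∈ G, cramerRateRd P x : ℝ≥0∞) : EReal)) := by
  have hP := fun c : ℝ => integrable_exp_mul_norm hΛ c
  exact ⟨fun F hF => iInf_cramerRateRd_le_liminf hP hF, fun G hG => limsup_le_iInf_cramerRateRd hG⟩
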